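/- Let f ∈ C([0,1]) be time-independent and let u be a classical solution of the bridge equation with forcing term f. Then for every t ≥ 0 the reduced energy satisfies 𝓔(t) ≤ 2𝓛(0) + (4/π⁴)‖f‖², where 𝓛(0) = E(0) − 2⟨u(0,·), f⟩. In particular, orbits of bounded initial data are bounded. -/

import Mathlib

open Real MeasureTheory

noncomputable section

/-- The `L²(0,1)` inner product `⟨u,v⟩`. -/
def ipL2 (u v : ℝ → ℝ) : ℝ := ∫ x in (0:ℝ)..1, u x * v x

/-- The squared `L²(0,1)` norm `‖u‖²`. -/
def nsqL2 (u : ℝ → ℝ) : ℝ := ∫ x in (0:ℝ)..1, (u x) ^ 2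

/-- Partial derivative in time. -/
def Dt (u : ℝ → ℝ → ℝ) : ℝ → ℝ → ℝ := fun t x => deriv (fun s => u s x) t

/-- Partial derivative in space. -/
def Dx (u : ℝ → ℝ → ℝ) : ℝ → ℝ → ℝ := fun t x => deriv (fun y => u t y) x

/-- A classical solution of the suspension-bridge equation
`∂ₜₜu + ∂ₓₓₓₓu + (p − ‖∂ₓu‖²)∂ₓₓu + ∂ₜu + k²u⁺ = f` on `[0,∞) × [0,1]`,
smooth up to the boundary, with pinned boundary conditions. -/
def IsClassicalSolution (p k : ℝ) (f u : ℝ → ℝ → ℝ) : Prop :=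
  ContDiff ℝ (⊤ : ℕ∞) (Function.uncurry u) ∧
  (∀ t ≥ (0:ℝ), ∀ x ∈ Set.Icc (0:ℝ) 1,
    Dt (Dt u) t x + Dx (Dx (Dx (Dx u))) t x
      + (p - nsqL2 (Dx u t)) * Dx (Dx u) t x
      + Dt u t x + k ^ 2 * max (u t x) 0 = f t x) ∧
  (∀ t ≥ (0:ℝ), u t 0 = 0 ∧ u t 1 = 0 ∧ Dx (Dx u) t 0 = 0 ∧ Dx (Dx u) t 1 = 0)

/-- The energy `E(t) = ‖∂ₜu‖² + ‖∂ₓₓu‖² + ½(‖∂ₓu‖² − p)² + k²‖u⁺‖²`. -/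
def energy (p k : ℝ) (u : ℝ → ℝ → ℝ) (t : ℝ) : ℝ :=
  nsqL2 (Dt u t) + nsqL2 (Dx (Dx u) t)
    + (1 / 2) * (nsqL2 (Dx u t) - p) ^ 2 + k ^ 2 * nsqL2 (fun x => max (u t x) 0)

/-- The reduced energy `𝓔(t) = ‖∂ₜu‖² + ‖∂ₓₓu‖²`. -/
def redEnergy (u : ℝ → ℝ → ℝ) (t : ℝ) : ℝ :=
  nsqL2 (Dt u t) + nsqL2 (Dx (Dx u) t)

section PartialDerivatives

variable {w : ℝ → ℝ → ℝ}

theorem hasDerivAt_Dt (hw : ContDiff ℝ (⊤ : ℕ∞) (Function.uncurry w)) (t x : ℝ) :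
    HasDerivAt (fun s => w s x) (Dt w t x) t := by
  have h : Differentiable ℝ (fun s => Function.uncurry w (s, x)) :=
    (hw.differentiable (by simp)).comp (by fun_prop)
  exact (h t).hasDerivAt

theorem hasDerivAt_Dx (hw : ContDiff ℝ (⊤ : ℕ∞) (Function.uncurry w)) (t x : ℝ) :
    HasDerivAt (w t) (Dx w t x) x := by
  have h : Differentiable ℝ (fun y => Function.uncurry w (t, y)) :=
    (hw.differentiable (by simp)).comp (by fun_prop)
  exact (h x).hasDerivAt

theorem Dt_eq_fderiv (hw : ContDiff ℝ (⊤ : ℕ∞) (Function.uncurry w)) :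
    Function.uncurry (Dt w) = fun q => fderiv ℝ (Function.uncurry w) q (1, 0) := by
  funext ⟨t, x⟩
  have h := ((hw.differentiable (by simp)) (t, x)).hasFDerivAt.comp_hasDerivAt t
    ((hasDerivAt_id t).prodMk (hasDerivAt_const t x))
  exact h.deriv

theorem Dx_eq_fderiv (hw : ContDiff ℝ (⊤ : ℕ∞) (Function.uncurry w)) :
    Function.uncurry (Dx w) = fun q => fderiv ℝ (Function.uncurry w) q (0, 1) := by
  funext ⟨t, x⟩
  have h := ((hw.differentiable (by simp)) (t, x)).hasFDerivAt.comp_hasDerivAt x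
    ((hasDerivAt_const x t).prodMk (hasDerivAt_id x))
  exact h.deriv

theorem contDiff_Dt (hw : ContDiff ℝ (⊤ : ℕ∞) (Function.uncurry w)) :
    ContDiff ℝ (⊤ : ℕ∞) (Function.uncurry (Dt w)) := by
  rw [Dt_eq_fderiv hw]
  exact (hw.fderiv_right (m := (⊤ : ℕ∞)) (by simp)).clm_apply contDiff_const

theorem contDiff_Dx (hw : ContDiff ℝ (⊤ : ℕ∞) (Function.uncurry w)) :
    ContDiff ℝ (⊤ : ℕ∞) (Function.uncurry (Dx w)) := by
  rw [Dx_eq_fderiv hw]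
  exact (hw.fderiv_right (m := (⊤ : ℕ∞)) (by simp)).clm_apply contDiff_const

theorem Dt_Dx_comm (hw : ContDiff ℝ (⊤ : ℕ∞) (Function.uncurry w)) :
    Dt (Dx w) = Dx (Dt w) := by
  have hd : Differentiable ℝ (fderiv ℝ (Function.uncurry w)) :=
    (hw.fderiv_right (m := (⊤ : ℕ∞)) (by simp)).differentiable (by simp)
  funext t x
  have h1 : Dt (Dx w) t x
      = fderiv ℝ (fderiv ℝ (Function.uncurry w)) (t, x) (1, 0) (0, 1) := by
    have := congrFun (Dt_eq_fderiv (contDiff_Dx hw)) (t, x)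
    rw [Dx_eq_fderiv hw, fderiv_clm_apply (hd _) (by fun_prop)] at this
    simpa using this
  have h2 : Dx (Dt w) t x
      = fderiv ℝ (fderiv ℝ (Function.uncurry w)) (t, x) (0, 1) (1, 0) := by
    have := congrFun (Dx_eq_fderiv (contDiff_Dt hw)) (t, x)
    rw [Dt_eq_fderiv hw, fderiv_clm_apply (hd _) (by fun_prop)] at this
    simpa using this
  rw [h1, h2]
  exact (hw.contDiffAt.isSymmSndFDerivAt
    (by simpa using WithTop.coe_le_coe.2 (le_top : (2 : ℕ∞) ≤ ⊤))).eq _ _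

theorem continuous_slice (hw : Continuous (Function.uncurry w)) (t : ℝ) : Continuous (w t) :=
  hw.comp (by fun_prop : Continuous fun x : ℝ => (t, x))

end PartialDerivatives

/-- Differentiation under the integral sign over a compact interval. -/
theorem hasDerivAt_integral_of_continuous {G G' : ℝ → ℝ → ℝ}
    (hG : Continuous (Function.uncurry G)) (hG' : Continuous (Function.uncurry G'))
    (h : ∀ t x, HasDerivAt (fun s => G s x) (G' t x) t) (a b t : ℝ) :
    HasDerivAt (fun s => ∫ x in a..b, G s x) (∫ x in a..b, G' t x) t := by
  obtain ⟨C, hC⟩ := ((isCompact_closedBall t 1).prod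
    (isCompact_uIcc (a := a) (b := b))).exists_bound_of_continuousOn hG'.continuousOn
  refine (intervalIntegral.hasDerivAt_integral_of_dominated_loc_of_deriv_le
    (bound := fun _ => C) (Metric.closedBall_mem_nhds t one_pos) ?_
    ((continuous_slice hG t).intervalIntegrable _ _)
    (continuous_slice hG' t).aestronglyMeasurable ?_ intervalIntegrable_const ?_).2
  · exact Filter.Eventually.of_forall fun s => (continuous_slice hG s).aestronglyMeasurable
  · exact Filter.Eventually.of_forall fun x hx s hs => hC (s, x) ⟨hs, Set.uIoc_subset_uIcc hx⟩
  · exact Filter.Eventually.of_forall fun x _ s _ => h s x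

theorem hasDerivAt_sq_max_zero (s : ℝ) :
    HasDerivAt (fun r : ℝ => (max r 0) ^ 2) (2 * max s 0) s := by
  rcases lt_trichotomy s 0 with hs | rfl | hs
  · rw [max_eq_right hs.le, mul_zero]
    refine (hasDerivAt_const s (0 : ℝ)).congr_of_eventuallyEq ?_
    filter_upwards [eventually_lt_nhds hs] with r hr
    simp [max_eq_right hr.le]
  · rw [hasDerivAt_iff_isLittleO]
    have hO : (fun r : ℝ => (max r 0) ^ 2) =O[nhds 0] fun r : ℝ => r ^ 2 := by
      refine Asymptotics.IsBigO.of_bound 1 (Filter.Eventually.of_forall fun r => ?_)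
      rcases le_total r 0 with hr | hr <;> simp [hr, sq_nonneg]
    have ho : (fun r : ℝ => r ^ 2) =o[nhds 0] fun r : ℝ => r := by
      simpa using Asymptotics.isLittleO_pow_id (𝕜 := ℝ) (n := 2) (by norm_num)
    simpa using hO.trans_isLittleO ho
  · rw [max_eq_left hs.le]
    refine HasDerivAt.congr_of_eventuallyEq (f := fun r => r ^ 2)
      (by simpa using hasDerivAt_pow 2 s) ?_
    filter_upwards [eventually_gt_nhds hs] with r hr
    simp [max_eq_left hr.le]

section IntegrationByParts

theorem integral_mul_deriv_eq_neg_of_boundary {g g' h h' : ℝ → ℝ}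
    (hg : ∀ x, HasDerivAt g (g' x) x) (hh : ∀ x, HasDerivAt h (h' x) x)
    (hg' : Continuous g') (hh' : Continuous h') {a b : ℝ}
    (ha : g a * h a = 0) (hb : g b * h b = 0) :
    ∫ x in a..b, g x * h' x = -∫ x in a..b, g' x * h x := by
  rw [intervalIntegral.integral_mul_deriv_eq_deriv_mul (fun x _ => hg x) (fun x _ => hh x)
    (hg'.intervalIntegrable _ _) (hh'.intervalIntegrable _ _), ha, hb]
  ring

/-- Wirtinger's inequality with a constant below the optimal one. -/
theorem sq_mul_nsqL2_le_of_lt_pi {g g' : ℝ → ℝ} (hg : ∀ x, HasDerivAt g (g' x) x)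
    (hg' : Continuous g') (h0 : g 0 = 0) (h1 : g 1 = 0) {c : ℝ} (hc0 : 0 < c) (hc : c < π) :
    c ^ 2 * nsqL2 g ≤ nsqL2 g' := by
  have hgc : Continuous g := continuous_iff_continuousAt.2 fun x => (hg x).continuousAt
  have hcos : ∀ x ∈ Set.uIcc (0 : ℝ) 1, cos (c * (x - 1 / 2)) ≠ 0 := by
    intro x hx
    rw [Set.uIcc_of_le zero_le_one] at hx
    exact (cos_pos_of_mem_Ioo ⟨by nlinarith [hx.1, hx.2], by nlinarith [hx.1, hx.2]⟩).ne'
  have htan : ContinuousOn (fun x => tan (c * (x - 1 / 2))) (Set.uIcc 0 1) := by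
    simp only [tan_eq_sin_div_cos]
    exact ContinuousOn.div (by fun_prop) (by fun_prop) hcos
  have hint : IntervalIntegrable (fun x => (g' x + c * tan (c * (x - 1 / 2)) * g x) ^ 2
      - (g' x) ^ 2 + c ^ 2 * (g x) ^ 2) volume 0 1 := by
    apply ContinuousOn.intervalIntegrable
    fun_prop
  have hzero := intervalIntegral.integral_eq_sub_of_hasDerivAt
    (f := fun x => c * tan (c * (x - 1 / 2)) * (g x) ^ 2) (a := 0) (b := 1)
    (f' := fun x => (g' x + c * tan (c * (x - 1 / 2)) * g x) ^ 2
      - (g' x) ^ 2 + c ^ 2 * (g x) ^ 2) (fun x hx => by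
      have hl : HasDerivAt (fun y : ℝ => c * (y - 1 / 2)) c x :=
        (((hasDerivAt_id x).sub_const (1 / 2)).const_mul c).congr_deriv (mul_one c)
      have ht := (hasDerivAt_tan (hcos x hx)).comp x hl
      refine ((ht.const_mul c).mul ((hg x).pow 2)).congr_deriv ?_
      have hsec : 1 / cos (c * (x - 1 / 2)) ^ 2 = 1 + tan (c * (x - 1 / 2)) ^ 2 := by
        rw [one_div, ← inv_one_add_tan_sq (hcos x hx), inv_inv]
      simp only [Function.comp_apply, hsec, Pi.pow_apply]
      push_cast
      ring) hint
  have hle : ∫ x in (0 : ℝ)..1, (c ^ 2 * (g x) ^ 2 - (g' x) ^ 2) ≤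
      ∫ x in (0 : ℝ)..1, ((g' x + c * tan (c * (x - 1 / 2)) * g x) ^ 2
        - (g' x) ^ 2 + c ^ 2 * (g x) ^ 2) := by
    refine intervalIntegral.integral_mono_on zero_le_one
      (Continuous.intervalIntegrable (by fun_prop) _ _) hint fun x _ => ?_
    nlinarith [sq_nonneg (g' x + c * tan (c * (x - 1 / 2)) * g x)]
  rw [hzero, intervalIntegral.integral_sub (Continuous.intervalIntegrable (by fun_prop) _ _)
    (Continuous.intervalIntegrable (by fun_prop) _ _),
    intervalIntegral.integral_const_mul] at hle
  simp only [h0, h1] at hle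
  unfold nsqL2
  linarith

/-- Wirtinger's inequality on `[0,1]` for functions vanishing at both endpoints. -/
theorem pi_sq_mul_nsqL2_le {g g' : ℝ → ℝ} (hg : ∀ x, HasDerivAt g (g' x) x)
    (hg' : Continuous g') (h0 : g 0 = 0) (h1 : g 1 = 0) :
    π ^ 2 * nsqL2 g ≤ nsqL2 g' := by
  have hlim : Filter.Tendsto (fun c : ℝ => c ^ 2 * nsqL2 g) (nhdsWithin π (Set.Iio π))
      (nhds (π ^ 2 * nsqL2 g)) :=
    ((by fun_prop : Continuous fun c : ℝ => c ^ 2 * nsqL2 g).tendsto π).mono_left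
      nhdsWithin_le_nhds
  refine le_of_tendsto hlim ?_
  filter_upwards [Ioo_mem_nhdsLT pi_pos] with c hc
  exact sq_mul_nsqL2_le_of_lt_pi hg hg' h0 h1 hc.1 hc.2

theorem two_mul_ipL2_le {g h : ℝ → ℝ} (hg : Continuous g) (hh : Continuous h) {a : ℝ}
    (ha : 0 < a) : 2 * ipL2 g h ≤ a * nsqL2 g + a⁻¹ * nsqL2 h := by
  unfold ipL2 nsqL2
  rw [← intervalIntegral.integral_const_mul, ← intervalIntegral.integral_const_mul,
    ← intervalIntegral.integral_const_mul, ← intervalIntegral.integral_add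
      (Continuous.intervalIntegrable (by fun_prop) _ _)
      (Continuous.intervalIntegrable (by fun_prop) _ _)]
  refine intervalIntegral.integral_mono_on zero_le_one
    (Continuous.intervalIntegrable (by fun_prop) _ _)
    (Continuous.intervalIntegrable (by fun_prop) _ _) fun x _ => ?_
  have : a * g x ^ 2 + a⁻¹ * h x ^ 2 - 2 * (g x * h x) = a⁻¹ * (a * g x - h x) ^ 2 := by
    field_simp
    ring
  have : 0 ≤ a⁻¹ * (a * g x - h x) ^ 2 := by positivity
  linarith

/-- The second-order Poincaré inequality, with the optimal constant `π⁴`. -/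
theorem pi_pow_four_mul_nsqL2_le {g g' g'' : ℝ → ℝ} (hg : ∀ x, HasDerivAt g (g' x) x)
    (hg' : ∀ x, HasDerivAt g' (g'' x) x) (hg'' : Continuous g'') (h0 : g 0 = 0) (h1 : g 1 = 0) :
    π ^ 4 * nsqL2 g ≤ nsqL2 g'' := by
  have hgc : Continuous g := continuous_iff_continuousAt.2 fun x => (hg x).continuousAt
  have hgc' : Continuous g' := continuous_iff_continuousAt.2 fun x => (hg' x).continuousAt
  have hW := pi_sq_mul_nsqL2_le hg hgc' h0 h1
  have hP := integral_mul_deriv_eq_neg_of_boundary hg hg' hgc' hg'' (a := 0) (b := 1)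
    (by simp [h0]) (by simp [h1])
  have hsq : ∫ x in (0 : ℝ)..1, g' x * g' x = nsqL2 g' := by simp only [nsqL2, sq]
  have hY := two_mul_ipL2_le (g := fun x => -g x) (h := g'') (by fun_prop) hg''
    (a := π ^ 2) (by positivity)
  have hneg : ipL2 (fun x => -g x) g'' = nsqL2 g' := by
    simp only [ipL2, neg_mul, intervalIntegral.integral_neg]
    rw [hP, hsq, neg_neg]
  have hneg' : nsqL2 (fun x => -g x) = nsqL2 g := by simp [nsqL2]
  rw [hneg, hneg'] at hY
  have hpi : 0 < π ^ 2 := by positivity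
  have h : π ^ 2 * nsqL2 g ≤ (π ^ 2)⁻¹ * nsqL2 g'' := by linarith
  calc π ^ 4 * nsqL2 g = π ^ 2 * (π ^ 2 * nsqL2 g) := by ring
    _ ≤ π ^ 2 * ((π ^ 2)⁻¹ * nsqL2 g'') := by gcongr
    _ = nsqL2 g'' := by field_simp

end IntegrationByParts

theorem hasDerivAt_nsqL2 {w : ℝ → ℝ → ℝ} (hw : ContDiff ℝ (⊤ : ℕ∞) (Function.uncurry w))
    (t : ℝ) : HasDerivAt (fun s => nsqL2 (w s)) (2 * ipL2 (w t) (Dt w t)) t := by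
  have hc : Continuous fun q : ℝ × ℝ => w q.1 q.2 := hw.continuous
  have hc' : Continuous fun q : ℝ × ℝ => Dt w q.1 q.2 := (contDiff_Dt hw).continuous
  have h := hasDerivAt_integral_of_continuous (G := fun s x => (w s x) ^ 2)
    (G' := fun s x => 2 * (w s x * Dt w s x))
    (by fun_prop : Continuous fun q : ℝ × ℝ => (w q.1 q.2) ^ 2)
    (by fun_prop : Continuous fun q : ℝ × ℝ => 2 * (w q.1 q.2 * Dt w q.1 q.2))
    (fun s x => by
      refine ((hasDerivAt_Dt hw s x).pow 2).congr_deriv ?_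
      push_cast
      ring) 0 1 t
  rw [intervalIntegral.integral_const_mul] at h
  exact h

theorem hasDerivAt_nsqL2_max {w : ℝ → ℝ → ℝ}
    (hw : ContDiff ℝ (⊤ : ℕ∞) (Function.uncurry w)) (t : ℝ) :
    HasDerivAt (fun s => nsqL2 (fun x => max (w s x) 0))
      (2 * ipL2 (fun x => max (w t x) 0) (Dt w t)) t := by
  have hc : Continuous fun q : ℝ × ℝ => w q.1 q.2 := hw.continuous
  have hc' : Continuous fun q : ℝ × ℝ => Dt w q.1 q.2 := (contDiff_Dt hw).continuous
  have h := hasDerivAt_integral_of_continuous (G := fun s x => (max (w s x) 0) ^ 2)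
    (G' := fun s x => 2 * (max (w s x) 0 * Dt w s x))
    (by fun_prop : Continuous fun q : ℝ × ℝ => (max (w q.1 q.2) 0) ^ 2)
    (by fun_prop : Continuous fun q : ℝ × ℝ => 2 * (max (w q.1 q.2) 0 * Dt w q.1 q.2))
    (fun s x => by
      refine ((hasDerivAt_sq_max_zero (w s x)).comp s (hasDerivAt_Dt hw s x)).congr_deriv ?_
      ring) 0 1 t
  rw [intervalIntegral.integral_const_mul] at h
  exact h

theorem hasDerivAt_ipL2_const {w : ℝ → ℝ → ℝ}
    (hw : ContDiff ℝ (⊤ : ℕ∞) (Function.uncurry w)) {f : ℝ → ℝ} (hf : Continuous f) (t : ℝ) :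
    HasDerivAt (fun s => ipL2 (w s) f) (ipL2 (Dt w t) f) t := by
  have hc : Continuous fun q : ℝ × ℝ => w q.1 q.2 := hw.continuous
  have hc' : Continuous fun q : ℝ × ℝ => Dt w q.1 q.2 := (contDiff_Dt hw).continuous
  exact hasDerivAt_integral_of_continuous (G := fun s x => w s x * f x)
    (G' := fun s x => Dt w s x * f x) (hc.mul (hf.comp continuous_snd))
    (hc'.mul (hf.comp continuous_snd)) (fun s x => (hasDerivAt_Dt hw s x).mul_const (f x)) 0 1 t

theorem hasDerivAt_energy (p k : ℝ) {f : ℝ → ℝ} (hf : Continuous f) {u : ℝ → ℝ → ℝ}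
    (hu : ContDiff ℝ (⊤ : ℕ∞) (Function.uncurry u)) (t : ℝ) :
    HasDerivAt (fun s => energy p k u s - 2 * ipL2 (u s) f)
      (2 * ipL2 (Dt u t) (Dt (Dt u) t) + 2 * ipL2 (Dx (Dx u) t) (Dt (Dx (Dx u)) t)
        + 2 * (nsqL2 (Dx u t) - p) * ipL2 (Dx u t) (Dt (Dx u) t)
        + 2 * k ^ 2 * ipL2 (fun x => max (u t x) 0) (Dt u t) - 2 * ipL2 (Dt u t) f) t := by
  have hx := contDiff_Dx hu
  have h1 := hasDerivAt_nsqL2 (contDiff_Dt hu) t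
  have h2 := hasDerivAt_nsqL2 (contDiff_Dx hx) t
  have h3 := (((hasDerivAt_nsqL2 hx t).sub_const p).pow 2).const_mul (1 / 2)
  have h4 := (hasDerivAt_nsqL2_max hu t).const_mul (k ^ 2)
  have h5 := (hasDerivAt_ipL2_const hu hf t).const_mul 2
  refine ((((h1.add h2).add h3).add h4).sub h5).congr_deriv ?_
  push_cast
  ring

theorem Dt_eq_zero_of_eq_zero {w : ℝ → ℝ → ℝ} {x : ℝ} (h : ∀ t ≥ (0 : ℝ), w t x = 0) {t : ℝ}
    (ht : 0 < t) : Dt w t x = 0 := by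
  have : (fun s => w s x) =ᶠ[nhds t] fun _ => 0 := by
    filter_upwards [eventually_gt_nhds ht] with s hs using h s hs.le
  exact this.deriv_eq.trans (deriv_const t 0)

theorem IsClassicalSolution.deriv_energy_eq {p k : ℝ} {f : ℝ → ℝ}
    {u : ℝ → ℝ → ℝ} (hu : IsClassicalSolution p k (fun _ x => f x) u) {t : ℝ} (ht : 0 < t) :
    2 * ipL2 (Dt u t) (Dt (Dt u) t) + 2 * ipL2 (Dx (Dx u) t) (Dt (Dx (Dx u)) t)
        + 2 * (nsqL2 (Dx u t) - p) * ipL2 (Dx u t) (Dt (Dx u) t)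
        + 2 * k ^ 2 * ipL2 (fun x => max (u t x) 0) (Dt u t) - 2 * ipL2 (Dt u t) f
      = -2 * nsqL2 (Dt u t) := by
  obtain ⟨hs, heq, hbc⟩ := hu
  have sx := contDiff_Dx hs
  have sxx := contDiff_Dx sx
  have sxxx := contDiff_Dx sxx
  have sxxxx := contDiff_Dx sxxx
  have st := contDiff_Dt hs
  have stx := contDiff_Dx st
  have stxx := contDiff_Dx stx
  have v0 : Dt u t 0 = 0 := Dt_eq_zero_of_eq_zero (fun s h => (hbc s h).1) ht
  have v1 : Dt u t 1 = 0 := Dt_eq_zero_of_eq_zero (fun s h => (hbc s h).2.1) ht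
  obtain ⟨-, -, w0, w1⟩ := hbc t ht.le
  have c := fun {w : ℝ → ℝ → ℝ} (h : ContDiff ℝ (⊤ : ℕ∞) (Function.uncurry w)) =>
    continuous_slice h.continuous t
  have i1 : ipL2 (Dx u t) (Dt (Dx u) t) = -ipL2 (Dx (Dx u) t) (Dt u t) := by
    rw [Dt_Dx_comm hs]
    exact integral_mul_deriv_eq_neg_of_boundary (hasDerivAt_Dx sx t) (hasDerivAt_Dx st t)
      (c sxx) (c stx) (by simp [v0]) (by simp [v1])
  have i2 : ipL2 (Dx (Dx u) t) (Dt (Dx (Dx u)) t) = ipL2 (Dx (Dx (Dx (Dx u))) t) (Dt u t) := by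
    rw [Dt_Dx_comm sx, Dt_Dx_comm hs]
    have e1 := integral_mul_deriv_eq_neg_of_boundary (a := 0) (b := 1) (hasDerivAt_Dx sxx t)
      (hasDerivAt_Dx stx t) (c sxxx) (c stxx) (by simp [w0]) (by simp [w1])
    have e2 := integral_mul_deriv_eq_neg_of_boundary (a := 0) (b := 1) (hasDerivAt_Dx sxxx t)
      (hasDerivAt_Dx st t) (c sxxxx) (c stx) (by simp [v0]) (by simp [v1])
    unfold ipL2
    rw [e1, e2, neg_neg]
  have cm : Continuous fun x => max (u t x) 0 := (c hs).max continuous_const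
  have hv : ∀ {g : ℝ → ℝ}, Continuous g →
      IntervalIntegrable (fun x => g x * Dt u t x) volume 0 1 :=
    fun hg => (hg.mul (c st)).intervalIntegrable _ _
  have hcomm : ∀ g : ℝ → ℝ, ipL2 (Dt u t) g = ipL2 g (Dt u t) := fun g => by
    simp only [ipL2, mul_comm]
  have hnsq : nsqL2 (Dt u t) = ipL2 (Dt u t) (Dt u t) := by simp only [nsqL2, ipL2, sq]
  have key : ipL2 f (Dt u t) = ipL2 (Dt (Dt u) t) (Dt u t)
      + ipL2 (Dx (Dx (Dx (Dx u))) t) (Dt u t)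
      + (p - nsqL2 (Dx u t)) * ipL2 (Dx (Dx u) t) (Dt u t)
      + ipL2 (Dt u t) (Dt u t) + k ^ 2 * ipL2 (fun x => max (u t x) 0) (Dt u t) := by
    have j1 := hv (c (contDiff_Dt st))
    have j2 := hv (c sxxxx)
    have j3 := (hv (c sxx)).const_mul (p - nsqL2 (Dx u t))
    have j4 := hv (c st)
    have j5 := (hv cm).const_mul (k ^ 2)
    unfold ipL2
    rw [← intervalIntegral.integral_const_mul, ← intervalIntegral.integral_const_mul,
      ← intervalIntegral.integral_add j1 j2, ← intervalIntegral.integral_add (j1.add j2) j3,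
      ← intervalIntegral.integral_add ((j1.add j2).add j3) j4,
      ← intervalIntegral.integral_add (((j1.add j2).add j3).add j4) j5]
    refine intervalIntegral.integral_congr fun x hx => ?_
    rw [Set.uIcc_of_le zero_le_one] at hx
    have := heq t ht.le x hx
    simp only [← this]
    ring
  rw [hcomm f, hcomm (Dt (Dt u) t), i1, i2, hnsq, key]
  ring

theorem IsClassicalSolution.antitoneOn_energy {p k : ℝ} {f : ℝ → ℝ} (hf : Continuous f)
    {u : ℝ → ℝ → ℝ} (hu : IsClassicalSolution p k (fun _ x => f x) u) :
    AntitoneOn (fun s => energy p k u s - 2 * ipL2 (u s) f) (Set.Ici 0) := by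
  have hd := hasDerivAt_energy p k hf hu.1
  refine antitoneOn_of_hasDerivWithinAt_nonpos (convex_Ici 0)
    (fun s _ => (hd s).continuousAt.continuousWithinAt) (fun s _ => (hd s).hasDerivWithinAt)
    fun s hs => ?_
  rw [interior_Ici] at hs
  rw [hu.deriv_energy_eq hs]
  have : 0 ≤ nsqL2 (Dt u s) :=
    intervalIntegral.integral_nonneg zero_le_one fun x _ => sq_nonneg _
  linarith

/-- Bounded orbits: for a time-independent forcing `f`, the reduced energy satisfies
`𝓔(t) ≤ 2𝓛(0) + (4/π⁴)‖f‖²` for all `t ≥ 0`, where `𝓛(0) = E(0) − 2⟨u(0,·), f⟩`. -/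
theorem bounded_orbits (p k : ℝ) (f : ℝ → ℝ) (hf : Continuous f)
    (u : ℝ → ℝ → ℝ) (hu : IsClassicalSolution p k (fun _ x => f x) u) :
    ∀ t ≥ (0:ℝ), redEnergy u t ≤
      2 * (energy p k u 0 - 2 * ipL2 (u 0) f) + (4 / π ^ 4) * nsqL2 f := by
  intro t ht
  have hmono := hu.antitoneOn_energy hf Set.self_mem_Ici (Set.mem_Ici.2 ht) ht
  simp only at hmono
  obtain ⟨hs, -, hbc⟩ := hu
  have sx := contDiff_Dx hs
  have hP := pi_pow_four_mul_nsqL2_le (hasDerivAt_Dx hs t) (hasDerivAt_Dx sx t)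
    (continuous_slice (contDiff_Dx sx).continuous t) (hbc t ht).1 (hbc t ht).2.1
  have hY := two_mul_ipL2_le (continuous_slice hs.continuous t) hf (a := π ^ 4 / 2)
    (by positivity)
  have hinv : (π ^ 4 / 2)⁻¹ * nsqL2 f = (4 / π ^ 4) * nsqL2 f / 2 := by
    field_simp
    ring
  rw [hinv] at hY
  have hpos : ∀ g : ℝ → ℝ, 0 ≤ nsqL2 g := fun g =>
    intervalIntegral.integral_nonneg zero_le_one fun x _ => sq_nonneg _
  have hv := hpos (Dt u t)
  have hm := mul_nonneg (sq_nonneg k) (hpos fun x => max (u t x) 0)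
  have hsq := sq_nonneg (nsqL2 (Dx u t) - p)
  have hE : energy p k u t = redEnergy u t + (1 / 2) * (nsqL2 (Dx u t) - p) ^ 2
    + k ^ 2 * nsqL2 (fun x => max (u t x) 0) := rfl
  have hR : redEnergy u t = nsqL2 (Dt u t) + nsqL2 (Dx (Dx u) t) := rfl
  linarith
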